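/- For every ε > 0 there exists D = D(π, ε) > 0 such that whenever d > D and 1/2 ≤ d·θ² ≤ 1, for all n: |x_{n+1} − f(d·θ²·x_n)| ≤ ε. -/

import Mathlib

open Finset Filter

namespace AsymIsing

/-- Level-`k` vertices of the rooted `d`-ary tree: paths of length `k` from the root. -/
abbrev Vert (d k : ℕ) : Type := Fin k → Fin d

/-- A spin configuration on levels `0, …, n` of the `d`-ary tree. -/
abbrev Conf (d n : ℕ) : Type := ∀ k : Fin (n + 1), Vert d k → Fin 2

/-- A spin configuration on level `n` only. -/
abbrev LConf (d n : ℕ) : Type := Vert d n → Fin 2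

/-- The transition matrix of the asymmetric binary channel; the paper's state `1`
corresponds to the index `0` and the state `2` to the index `1`. -/
noncomputable def Mmat (θ Δ : ℝ) : Fin 2 → Fin 2 → ℝ := fun i j =>
  if i = 0 then (if j = 0 then (1 + θ - Δ) / 2 else (1 - θ + Δ) / 2)
  else (if j = 0 then (1 - θ - Δ) / 2 else (1 + θ + Δ) / 2)

/-- The stationary distribution `π = (π₁, π₂)` of the channel. -/
noncomputable def pst (θ Δ : ℝ) : Fin 2 → ℝ := fun i =>
  if i = 0 then 1 / 2 - Δ / (2 * (1 - θ)) else 1 / 2 + Δ / (2 * (1 - θ))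

/-- The root spin of a configuration. -/
def root {d n : ℕ} (σ : Conf d n) : Fin 2 := σ ⟨0, n.succ_pos⟩ (fun i => i.elim0)

/-- The restriction of a configuration to the last (`n`-th) level. -/
def top {d n : ℕ} (σ : Conf d n) : LConf d n := σ (Fin.last n)

/-- The probability of a full configuration on levels `0, …, n` under the broadcast
process: the root is drawn from `π` and spins propagate along edges via `M`. -/
noncomputable def confProb (d : ℕ) (θ Δ : ℝ) (n : ℕ) (σ : Conf d n) : ℝ :=
  pst θ Δ (root σ) *
    ∏ k : Fin n, ∏ v : Vert d (k + 1),
      Mmat θ Δ (σ k.castSucc (v ∘ Fin.castSucc)) (σ k.succ v)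

/-- `P(σ(n) = A)`: the marginal law of the level-`n` spins. -/
noncomputable def levelProb (d : ℕ) (θ Δ : ℝ) (n : ℕ) (A : LConf d n) : ℝ :=
  ∑ σ : Conf d n, if top σ = A then confProb d θ Δ n σ else 0

/-- `P(σ_ρ = i, σ(n) = A)`. -/
noncomputable def jointProb (d : ℕ) (θ Δ : ℝ) (n : ℕ) (i : Fin 2) (A : LConf d n) : ℝ :=
  ∑ σ : Conf d n, if root σ = i ∧ top σ = A then confProb d θ Δ n σ else 0

/-- The posterior `f_n(i, A) = P(σ_ρ = i ∣ σ(n) = A)`. -/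
noncomputable def post (d : ℕ) (θ Δ : ℝ) (n : ℕ) (i : Fin 2) (A : LConf d n) : ℝ :=
  jointProb d θ Δ n i A / levelProb d θ Δ n A

/-- The law of `σ^i(n)`, i.e. `P(σ(n) = A ∣ σ_ρ = i)`. -/
noncomputable def condLevel (d : ℕ) (θ Δ : ℝ) (n : ℕ) (i : Fin 2) (A : LConf d n) : ℝ :=
  jointProb d θ Δ n i A / pst θ Δ i

/-- The total variation distance between `σ^1(n)` and `σ^2(n)`. -/
noncomputable def tvDist (d : ℕ) (θ Δ : ℝ) (n : ℕ) : ℝ :=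
  (1 / 2) * ∑ A : LConf d n, |condLevel d θ Δ n 0 A - condLevel d θ Δ n 1 A|

/-- The reconstruction problem is solvable if `limsup_n d_TV(σ^1(n), σ^2(n)) > 0`. -/
def solvable (d : ℕ) (θ Δ : ℝ) : Prop :=
  0 < Filter.limsup (fun n => tvDist d θ Δ n) Filter.atTop

/-- Non-reconstruction: `limsup_n d_TV(σ^1(n), σ^2(n)) = 0`. -/
def nonReconstruction (d : ℕ) (θ Δ : ℝ) : Prop :=
  Filter.limsup (fun n => tvDist d θ Δ n) Filter.atTop = 0

/-- Expectation of a function of the level-`n` configuration, conditioned on `σ_ρ = 1`. -/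
noncomputable def expect1 (d : ℕ) (θ Δ : ℝ) (n : ℕ) (g : LConf d n → ℝ) : ℝ :=
  ∑ A : LConf d n, condLevel d θ Δ n 0 A * g A

/-- `x_n = E f_n(1, σ^1(n)) − π₁`. -/
noncomputable def xseq (d : ℕ) (θ Δ : ℝ) (n : ℕ) : ℝ :=
  expect1 d θ Δ n (fun A => post d θ Δ n 0 A) - pst θ Δ 0

/-- `z_n = E (f_n(1, σ^1(n)) − π₁)²`. -/
noncomputable def zseq (d : ℕ) (θ Δ : ℝ) (n : ℕ) : ℝ :=
  expect1 d θ Δ n (fun A => (post d θ Δ n 0 A - pst θ Δ 0) ^ 2)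

/-- The restriction of a level-`(n+1)` configuration to the subtree of the `j`-th
child of the root (paths starting with `j`). -/
def restrictChild {d n : ℕ} (j : Fin d) (A : LConf d (n + 1)) : LConf d n :=
  fun w => A (Fin.cons j w)

/-- `Y_j = f_n(1, σ_j(n+1))`, as a function of the level-`(n+1)` configuration. -/
noncomputable def Yfun (d : ℕ) (θ Δ : ℝ) (n : ℕ) (j : Fin d) (A : LConf d (n + 1)) : ℝ :=
  post d θ Δ n 0 (restrictChild j A)

/-- `Z₁ = ∏_j (1 + (θ/π₁)(Y_j − π₁))`, as a function of the level-`(n+1)` configuration. -/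
noncomputable def Z1fun (d : ℕ) (θ Δ : ℝ) (n : ℕ) (A : LConf d (n + 1)) : ℝ :=
  ∏ j : Fin d, (1 + (θ / pst θ Δ 0) * (Yfun d θ Δ n j A - pst θ Δ 0))

/-- `Z₂ = ∏_j (1 − (θ/π₂)(Y_j − π₁))`, as a function of the level-`(n+1)` configuration. -/
noncomputable def Z2fun (d : ℕ) (θ Δ : ℝ) (n : ℕ) (A : LConf d (n + 1)) : ℝ :=
  ∏ j : Fin d, (1 - (θ / pst θ Δ 1) * (Yfun d θ Δ n j A - pst θ Δ 0))

/-- The value of `Δ` making `π = (π₁, π₂)` the stationary distribution of the channel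
with second eigenvalue `θ`, namely `Δ = (1 − θ)(π₂ − π₁)`. -/
noncomputable def Dlt (θ π1 π2 : ℝ) : ℝ := (1 - θ) * (π2 - π1)

/-- The Gaussian-approximation function
`f(s) = E[π₁ e^{sμ₁+√s W₁} / (π₁ e^{sμ₁+√s W₁} + π₂ e^{sμ₂+√s W₂})] − π₁`,
where `μ₁ = 1/(2π₁)`, `μ₂ = −(1+π₂)/(2π₂²)`, `W₁ ∼ N(0, 1/π₁)` (realized as `w/√π₁`
for `w` standard Gaussian) and `W₂ = −(π₁/π₂)·W₁`. -/
noncomputable def gfun (π1 π2 : ℝ) (s : ℝ) : ℝ :=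
  (∫ w : ℝ,
      (π1 * Real.exp (s * (1 / (2 * π1)) + Real.sqrt s * (w / Real.sqrt π1))) /
        (π1 * Real.exp (s * (1 / (2 * π1)) + Real.sqrt s * (w / Real.sqrt π1)) +
          π2 * Real.exp (s * (-(1 + π2) / (2 * π2 ^ 2)) +
            Real.sqrt s * (-(π1 / π2) * (w / Real.sqrt π1))))
    ∂(ProbabilityTheory.gaussianReal 0 1)) - π1

/-! ### The recursive structure of the broadcast process -/

/-- The weight of a configuration given its root spin. -/
noncomputable def confWeight (d : ℕ) (θ Δ : ℝ) (n : ℕ) (σ : Conf d n) : ℝ :=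
  ∏ k : Fin n, ∏ v : Vert d (k + 1),
    Mmat θ Δ (σ k.castSucc (v ∘ Fin.castSucc)) (σ k.succ v)

/-- The likelihood `P(σ(n) = A ∣ σ_ρ = i)`. -/
noncomputable def lik (d : ℕ) (θ Δ : ℝ) (n : ℕ) (i : Fin 2) (A : LConf d n) : ℝ :=
  ∑ σ : Conf d n, if root σ = i ∧ top σ = A then confWeight d θ Δ n σ else 0

theorem jointProb_eq (d : ℕ) (θ Δ : ℝ) (n : ℕ) (i : Fin 2) (A : LConf d n) :
    jointProb d θ Δ n i A = pst θ Δ i * lik d θ Δ n i A := by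
  rw [jointProb, lik, Finset.mul_sum]
  refine Finset.sum_congr rfl fun σ _ => ?_
  split_ifs with h
  · rw [confProb, confWeight, h.1]
  · simp

theorem levelProb_eq (d : ℕ) (θ Δ : ℝ) (n : ℕ) (A : LConf d n) :
    levelProb d θ Δ n A = pst θ Δ 0 * lik d θ Δ n 0 A + pst θ Δ 1 * lik d θ Δ n 1 A := by
  rw [← jointProb_eq, ← jointProb_eq, levelProb, jointProb, jointProb, ← Finset.sum_add_distrib]
  refine Finset.sum_congr rfl fun σ _ => ?_
  obtain h | h : root σ = 0 ∨ root σ = 1 := by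
    generalize root σ = r
    fin_cases r <;> simp
  · simp [h]
  · simp [h]

/-- The configuration with a given root spin and given restrictions to the children's subtrees. -/
def joinConf {d n : ℕ} (p : Fin 2 × (Fin d → Conf d n)) : Conf d (n + 1)
  | ⟨0, _⟩, _ => p.1
  | ⟨k + 1, h⟩, v =>
    p.2 ((v : Vert d (k + 1)) 0) ⟨k, Nat.lt_of_succ_lt_succ h⟩ (Fin.tail (v : Vert d (k + 1)))

/-- A configuration on levels `0, …, n + 1` is a root spin together with a configuration
on the subtree of each child of the root. -/
def confEquiv (d n : ℕ) : Conf d (n + 1) ≃ Fin 2 × (Fin d → Conf d n) where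
  toFun σ := (root σ, fun j k w => σ k.succ (Fin.cons j w : Vert d (k + 1)))
  invFun := joinConf
  left_inv σ := by
    funext k v
    obtain ⟨k, hk⟩ := k
    cases k with
    | zero => exact congrArg (σ ⟨0, hk⟩) (Subsingleton.elim (α := Vert d 0) _ _)
    | succ k => exact congrArg (σ ⟨k + 1, hk⟩) (Fin.cons_self_tail (v : Vert d (k + 1)))
  right_inv _ := rfl

/-- A level-`(n + 1)` configuration is a level-`n` configuration below each child of the root. -/
def lconfEquiv (d n : ℕ) : LConf d (n + 1) ≃ (Fin d → LConf d n) where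
  toFun A := fun j => restrictChild j A
  invFun B := fun v => B (v 0) (Fin.tail v)
  left_inv A := by
    funext v
    exact congrArg A (Fin.cons_self_tail v)
  right_inv B := rfl

theorem root_confEquiv_symm {d n : ℕ} (p : Fin 2 × (Fin d → Conf d n)) :
    root ((confEquiv d n).symm p) = p.1 := rfl

theorem top_confEquiv_symm {d n : ℕ} (p : Fin 2 × (Fin d → Conf d n)) :
    top ((confEquiv d n).symm p) = (lconfEquiv d n).symm fun j => top (p.2 j) := by
  funext v
  rfl

theorem prod_vert_succ {d k : ℕ} (f : Vert d (k + 1) → ℝ) :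
    ∏ v, f v = ∏ j : Fin d, ∏ w : Vert d k, f (Fin.cons j w) := by
  rw [← (Fin.consEquiv fun _ : Fin (k + 1) => Fin d).prod_comp, Fintype.prod_prod_type]
  rfl

theorem confWeight_confEquiv_symm (d : ℕ) (θ Δ : ℝ) (n : ℕ)
    (p : Fin 2 × (Fin d → Conf d n)) :
    confWeight d θ Δ (n + 1) ((confEquiv d n).symm p) =
      ∏ j, Mmat θ Δ p.1 (root (p.2 j)) * confWeight d θ Δ n (p.2 j) := by
  rw [confWeight, Fin.prod_univ_succ, Finset.prod_mul_distrib]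
  congr 1
  · refine (prod_vert_succ (k := 0) _).trans ?_
    refine Finset.prod_congr rfl fun j _ => ?_
    rw [Fintype.prod_unique]
    exact congrArg (fun w => Mmat θ Δ p.1 (p.2 j 0 w)) (Subsingleton.elim (α := Vert d 0) _ _)
  · simp only [confWeight]
    rw [Finset.prod_comm]
    refine Finset.prod_congr rfl fun k _ => ?_
    exact prod_vert_succ (k := k + 1) _

theorem lik_succ (d : ℕ) (θ Δ : ℝ) (n : ℕ) (i : Fin 2) (B : Fin d → LConf d n) :
    lik d θ Δ (n + 1) i ((lconfEquiv d n).symm B) =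
      ∏ j, (Mmat θ Δ i 0 * lik d θ Δ n 0 (B j) + Mmat θ Δ i 1 * lik d θ Δ n 1 (B j)) := by
  have step : ∀ A : LConf d n,
      Mmat θ Δ i 0 * lik d θ Δ n 0 A + Mmat θ Δ i 1 * lik d θ Δ n 1 A =
        ∑ τ : Conf d n,
          if top τ = A then Mmat θ Δ i (root τ) * confWeight d θ Δ n τ else 0 := by
    intro A
    simp only [lik, Finset.mul_sum]
    rw [← Finset.sum_add_distrib]
    refine Finset.sum_congr rfl fun τ _ => ?_
    obtain h | h : root τ = 0 ∨ root τ = 1 := by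
      generalize root τ = r
      fin_cases r <;> simp
    · simp [h]
    · simp [h]
  simp only [step]
  rw [Fintype.prod_sum, lik, ← (confEquiv d n).symm.sum_comp, Fintype.sum_prod_type]
  simp only [root_confEquiv_symm, top_confEquiv_symm, confWeight_confEquiv_symm,
    Equiv.apply_eq_iff_eq, Finset.prod_ite_zero, funext_iff, Finset.mem_univ, true_imp_iff]
  rw [Finset.sum_eq_single i]
  · simp
  · intro b _ hb
    simp [hb]
  · simp

theorem lik_nonneg {d : ℕ} {θ Δ : ℝ} (hM : ∀ i j, 0 < Mmat θ Δ i j) (n : ℕ) (i : Fin 2)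
    (A : LConf d n) : 0 ≤ lik d θ Δ n i A := by
  refine Finset.sum_nonneg fun σ _ => ?_
  split_ifs
  · exact Finset.prod_nonneg fun k _ => Finset.prod_nonneg fun v _ => (hM _ _).le
  · exact le_rfl

theorem lik_zero (d : ℕ) (θ Δ : ℝ) (i : Fin 2) (A : LConf d 0) :
    lik d θ Δ 0 i A = if A = fun _ => i then 1 else 0 := by
  have key : ∀ σ : Conf d 0, (root σ = i ∧ top σ = A) ↔
      ((A = fun _ => i) ∧ σ = fun k => Fin.cases A (fun l => l.elim0) k) := by
    intro σ
    constructor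
    · rintro ⟨h, rfl⟩
      refine ⟨?_, ?_⟩
      · funext v
        rw [← h]
        exact congrArg (σ 0) (Subsingleton.elim (α := Vert d 0) _ _)
      · funext k
        refine Fin.cases rfl (fun l => l.elim0) k
    · rintro ⟨rfl, rfl⟩
      exact ⟨rfl, rfl⟩
  simp only [lik, key, confWeight, Finset.univ_eq_empty, Finset.prod_empty]
  by_cases h : A = fun _ => i <;> simp [h]

theorem lik_pos_or {d : ℕ} {θ Δ : ℝ} (hM : ∀ i j, 0 < Mmat θ Δ i j) (n : ℕ)
    (A : LConf d n) : 0 < lik d θ Δ n 0 A ∨ 0 < lik d θ Δ n 1 A := by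
  induction n with
  | zero =>
    obtain h | h : A Fin.elim0 = 0 ∨ A Fin.elim0 = 1 := by
      generalize A Fin.elim0 = r
      fin_cases r <;> simp
    · left
      have : A = fun _ => 0 := by
        funext v
        rw [← h]
        exact congrArg A (Subsingleton.elim _ _)
      rw [lik_zero, if_pos this]
      exact one_pos
    · right
      have : A = fun _ => 1 := by
        funext v
        rw [← h]
        exact congrArg A (Subsingleton.elim _ _)
      rw [lik_zero, if_pos this]
      exact one_pos
  | succ n ih =>
    left
    obtain ⟨B, rfl⟩ := (lconfEquiv d n).symm.surjective A
    rw [lik_succ]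
    refine Finset.prod_pos fun j _ => ?_
    have h0 := lik_nonneg hM n 0 (B j)
    have h1 := lik_nonneg hM n 1 (B j)
    rcases ih (B j) with h | h
    · exact add_pos_of_pos_of_nonneg (mul_pos (hM _ _) h) (mul_nonneg (hM _ _).le h1)
    · exact add_pos_of_nonneg_of_pos (mul_nonneg (hM _ _).le h0) (mul_pos (hM _ _) h)

theorem Mmat_row_sum (θ Δ : ℝ) (i : Fin 2) : Mmat θ Δ i 0 + Mmat θ Δ i 1 = 1 := by
  fin_cases i <;> simp [Mmat] <;> ring

theorem sum_lik (d : ℕ) (θ Δ : ℝ) (n : ℕ) (i : Fin 2) : ∑ A, lik d θ Δ n i A = 1 := by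
  induction n generalizing i with
  | zero => simp [lik_zero]
  | succ n ih =>
    rw [← (lconfEquiv d n).symm.sum_comp]
    simp only [lik_succ]
    rw [← Fintype.prod_sum
      (fun (_ : Fin d) A => Mmat θ Δ i 0 * lik d θ Δ n 0 A + Mmat θ Δ i 1 * lik d θ Δ n 1 A)]
    simp [Finset.sum_add_distrib, ← Finset.mul_sum, ih, Mmat_row_sum]

/-! ### Third-order Taylor bounds -/

theorem abs_le_pow_succ_of_hasDerivAt {R R' : ℝ → ℝ} {n : ℕ} (h0 : R 0 = 0)
    (hR : ∀ y, HasDerivAt R (R' y) y) (hb : ∀ y, |R' y| ≤ |y| ^ n) (y : ℝ) :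
    |R y| ≤ |y| ^ (n + 1) := by
  have := Convex.norm_image_sub_le_of_norm_hasDerivWithin_le (f := R) (f' := R')
    (s := Set.uIcc 0 y) (C := |y| ^ n) (x := 0) (y := y)
    (fun z _ => (hR z).hasDerivWithinAt)
    (fun z hz => (hb z).trans (pow_le_pow_left₀ (abs_nonneg z) (by
      have := Set.abs_sub_left_of_mem_uIcc hz
      rwa [sub_zero, sub_zero] at this) n))
    (convex_uIcc 0 y) Set.left_mem_uIcc Set.right_mem_uIcc
  simpa [h0, pow_succ] using this

theorem abs_taylor_two_le {h h1 h2 h3 : ℝ → ℝ} (d0 : ∀ y, HasDerivAt h (h1 y) y)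
    (d1 : ∀ y, HasDerivAt h1 (h2 y) y) (d2 : ∀ y, HasDerivAt h2 (h3 y) y)
    (hb : ∀ y, |h3 y| ≤ 1) (u y : ℝ) :
    |h (u + y) - h u - h1 u * y - h2 u / 2 * y ^ 2| ≤ |y| ^ 3 := by
  have e2 : ∀ y, |h2 (u + y) - h2 u| ≤ |y| ^ 1 :=
    abs_le_pow_succ_of_hasDerivAt (n := 0) (R := fun y => h2 (u + y) - h2 u)
      (R' := fun y => h3 (u + y)) (by simp)
      (fun y => ((d2 (u + y)).comp_const_add u y).sub_const _) (by simpa using fun y => hb (u + y))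
  have e1 : ∀ y, |h1 (u + y) - h1 u - h2 u * y| ≤ |y| ^ 2 :=
    abs_le_pow_succ_of_hasDerivAt (n := 1) (R := fun y => h1 (u + y) - h1 u - h2 u * y)
      (R' := fun y => h2 (u + y) - h2 u) (by simp)
      (fun y => by
        have := (((d1 (u + y)).comp_const_add u y).sub_const (h1 u)).sub
          ((hasDerivAt_id y).const_mul (h2 u))
        exact this.congr_deriv (by simp)) e2
  exact abs_le_pow_succ_of_hasDerivAt (n := 2)
      (R := fun y => h (u + y) - h u - h1 u * y - h2 u / 2 * y ^ 2)
      (R' := fun y => h1 (u + y) - h1 u - h2 u * y) (by simp)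
      (fun y => by
        have := ((((d0 (u + y)).comp_const_add u y).sub_const (h u)).sub
          ((hasDerivAt_id y).const_mul (h1 u))).sub ((hasDerivAt_pow 2 y).const_mul (h2 u / 2))
        refine this.congr_deriv ?_
        simp
        ring) e1 y

/-- The posterior probability of the first state when the log-likelihood ratio is `u`. -/
noncomputable def logitPost (π1 π2 u : ℝ) : ℝ := π1 / (π1 + π2 * Real.exp (-u))

section logitPost

variable {π1 π2 : ℝ}

theorem logitPost_mem (h1 : 0 < π1) (h2 : 0 < π2) (u : ℝ) :
    0 ≤ logitPost π1 π2 u ∧ logitPost π1 π2 u ≤ 1 := by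
  have := Real.exp_pos (-u)
  have h : 0 < π2 * Real.exp (-u) := by positivity
  refine ⟨by unfold logitPost; positivity, ?_⟩
  rw [logitPost, div_le_one (by positivity)]
  linarith

theorem continuous_logitPost (h1 : 0 < π1) (h2 : 0 < π2) : Continuous (logitPost π1 π2) := by
  unfold logitPost
  refine Continuous.div (by fun_prop) (by fun_prop) fun u => ?_
  have := Real.exp_pos (-u)
  positivity

theorem hasDerivAt_logitPost (h1 : 0 < π1) (h2 : 0 < π2) (u : ℝ) :
    HasDerivAt (logitPost π1 π2) (logitPost π1 π2 u * (1 - logitPost π1 π2 u)) u := by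
  have hpos : 0 < π1 + π2 * Real.exp (-u) := by
    have := Real.exp_pos (-u)
    positivity
  have hd : HasDerivAt (fun u => π1 + π2 * Real.exp (-u)) (π2 * (Real.exp (-u) * -1)) u :=
    (((hasDerivAt_neg u).exp).const_mul π2).const_add π1
  refine ((hasDerivAt_const u π1).div hd hpos.ne').congr_deriv ?_
  unfold logitPost
  field_simp
  ring

/-- The logistic function has second-order Taylor expansions with uniform cubic error. -/
theorem exists_taylor_logitPost (h1 : 0 < π1) (h2 : 0 < π2) (u : ℝ) :
    ∃ p q : ℝ, |p| ≤ 1 ∧ |q| ≤ 1 ∧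
      ∀ y, |logitPost π1 π2 (u + y) - logitPost π1 π2 u - p * y - q * y ^ 2| ≤ |y| ^ 3 := by
  set ψ := logitPost π1 π2 with hψ
  have d0 : ∀ y, HasDerivAt ψ (ψ y * (1 - ψ y)) y := hasDerivAt_logitPost h1 h2
  have d1 : ∀ y, HasDerivAt (fun y => ψ y * (1 - ψ y)) (ψ y * (1 - ψ y) * (1 - 2 * ψ y)) y := by
    intro y
    refine ((d0 y).mul ((d0 y).const_sub 1)).congr_deriv ?_
    ring
  have d2 : ∀ y, HasDerivAt (fun y => ψ y * (1 - ψ y) * (1 - 2 * ψ y))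
      (ψ y * (1 - ψ y) * (1 - 6 * ψ y * (1 - ψ y))) y := by
    intro y
    refine ((d1 y).mul (((d0 y).const_mul 2).const_sub 1)).congr_deriv ?_
    ring
  have hb : ∀ y, 0 ≤ ψ y * (1 - ψ y) ∧ ψ y * (1 - ψ y) ≤ 1 / 4 := by
    intro y
    have := logitPost_mem h1 h2 y
    rw [← hψ] at this
    exact ⟨mul_nonneg this.1 (by linarith), by nlinarith [sq_nonneg (ψ y - 1 / 2)]⟩
  refine ⟨ψ u * (1 - ψ u), ψ u * (1 - ψ u) * (1 - 2 * ψ u) / 2, ?_, ?_,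
    fun y => abs_taylor_two_le d0 d1 d2 (fun y => ?_) u y⟩
  · rw [abs_le]
    constructor <;> linarith [hb u]
  · have := logitPost_mem h1 h2 u
    rw [← hψ] at this
    have := hb u
    rw [abs_le]
    constructor <;> nlinarith
  · have := hb y
    rw [abs_le]
    constructor <;> nlinarith

/-- The log-likelihood ratio contributed by a child whose weighted posterior deviation is `t`. -/
noncomputable def llr (π1 π2 t : ℝ) : ℝ := Real.log (1 + t / π1) - Real.log (1 - t / π2)

theorem abs_log_one_sub_add_le {x : ℝ} (hx : |x| ≤ 1 / 2) :
    |Real.log (1 - x) + x + x ^ 2 / 2| ≤ 2 * |x| ^ 3 := by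
  have h := Real.abs_log_sub_add_sum_range_le (lt_of_le_of_lt hx (by norm_num)) 2
  have e : (∑ i ∈ range 2, x ^ (i + 1) / ((i : ℝ) + 1)) + Real.log (1 - x) =
      Real.log (1 - x) + x + x ^ 2 / 2 := by
    simp [Finset.sum_range_succ]
    ring
  rw [e] at h
  refine h.trans ?_
  rw [div_le_iff₀ (by linarith)]
  have : 0 ≤ |x| ^ 3 := by positivity
  norm_num
  nlinarith

theorem abs_llr_sub_le (h2 : 0 < π2) (h21 : π2 ≤ π1) {t : ℝ} (ht : |t| ≤ π2 / 2) :
    |llr π1 π2 t - (1 / π1 + 1 / π2) * t - (1 / π2 ^ 2 - 1 / π1 ^ 2) / 2 * t ^ 2| ≤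
      4 / π2 ^ 3 * |t| ^ 3 := by
  have h1 : 0 < π1 := h2.trans_le h21
  have b1 : |-(t / π1)| ≤ |t| / π2 := by
    rw [abs_neg, abs_div, abs_of_pos h1]
    gcongr
  have b2 : |t / π2| ≤ |t| / π2 := by rw [abs_div, abs_of_pos h2]
  have b3 : |t| / π2 ≤ 1 / 2 := by
    rw [div_le_iff₀ h2]
    linarith
  have l1 := abs_log_one_sub_add_le (b1.trans b3)
  have l2 := abs_log_one_sub_add_le (b2.trans b3)
  have c1 : |-(t / π1)| ^ 3 ≤ (|t| / π2) ^ 3 := by gcongr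
  have c2 : |t / π2| ^ 3 ≤ (|t| / π2) ^ 3 := by gcongr
  have e : llr π1 π2 t - (1 / π1 + 1 / π2) * t - (1 / π2 ^ 2 - 1 / π1 ^ 2) / 2 * t ^ 2 =
      (Real.log (1 - -(t / π1)) + -(t / π1) + (-(t / π1)) ^ 2 / 2) -
        (Real.log (1 - t / π2) + t / π2 + (t / π2) ^ 2 / 2) := by
    rw [llr, sub_neg_eq_add]
    ring
  rw [e]
  refine (abs_sub _ _).trans ?_
  have : 4 / π2 ^ 3 * |t| ^ 3 = 4 * (|t| / π2) ^ 3 := by ring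
  rw [this]
  linarith

end logitPost

/-! ### Comparison with a Gaussian -/

section Gaussian

open MeasureTheory ProbabilityTheory
open scoped NNReal

theorem integrable_of_continuous_of_abs_le_one {μ : Measure ℝ} [IsProbabilityMeasure μ]
    {h : ℝ → ℝ} (hc : Continuous h) (hb : ∀ y, |h y| ≤ 1) : Integrable h μ :=
  Integrable.of_bound hc.aestronglyMeasurable 1 (Eventually.of_forall hb)

theorem integral_gaussianReal_eq_standard {h : ℝ → ℝ} (hc : Continuous h) (a b : ℝ) {v : ℝ≥0}
    (hv : (v : ℝ) = b ^ 2) :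
    ∫ y, h y ∂gaussianReal a v = ∫ w, h (a + b * w) ∂gaussianReal 0 1 := by
  have e : gaussianReal a v = (gaussianReal 0 1).map fun w => a + b * w := by
    have : (fun w : ℝ => a + b * w) = (fun w => a + w) ∘ fun w => b * w := rfl
    rw [this, ← Measure.map_map (by fun_prop) (by fun_prop), gaussianReal_map_const_mul,
      gaussianReal_map_const_add]
    congr 1
    · simp
    · ext
      simp [hv]
  rw [e, integral_map (by fun_prop) hc.aestronglyMeasurable]

/-- Replacing the independent summands of a finitely supported law by Gaussian ones, one at a
time, costs at most the one-summand error each. -/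
theorem abs_sum_prod_sub_integral_gaussianReal_le {Ω : Type*} [Fintype Ω] {p ξ : Ω → ℝ}
    {h : ℝ → ℝ} {a δ : ℝ} {v : ℝ≥0} (hp : ∀ ω, 0 ≤ p ω) (hp1 : ∑ ω, p ω = 1)
    (hc : Continuous h) (hb : ∀ y, |h y| ≤ 1)
    (hstep : ∀ u, |∑ ω, p ω * h (u + ξ ω) - ∫ y, h (u + y) ∂gaussianReal a v| ≤ δ)
    (k : ℕ) (u : ℝ) :
    |∑ A : Fin k → Ω, (∏ j, p (A j)) * h (u + ∑ j, ξ (A j)) -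
      ∫ y, h (u + y) ∂gaussianReal (k * a) (k * v)| ≤ k * δ := by
  have hshift : ∀ (μ : Measure ℝ) [IsProbabilityMeasure μ] (u : ℝ),
      Integrable (fun y => h (u + y)) μ := fun μ _ u =>
    integrable_of_continuous_of_abs_le_one (by fun_prop) fun y => hb _
  induction k generalizing u with
  | zero => simp
  | succ k ih =>
    set F : ℝ → ℝ := fun u => ∑ A : Fin k → Ω, (∏ j, p (A j)) * h (u + ∑ j, ξ (A j)) with hF
    have e1 : ∑ A : Fin (k + 1) → Ω, (∏ j, p (A j)) * h (u + ∑ j, ξ (A j)) =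
        ∑ ω, p ω * F (u + ξ ω) := by
      rw [← (Fin.consEquiv fun _ : Fin (k + 1) => Ω).sum_comp, Fintype.sum_prod_type]
      refine Finset.sum_congr rfl fun ω _ => ?_
      rw [hF, Finset.mul_sum]
      refine Finset.sum_congr rfl fun A _ => ?_
      simp [Fin.consEquiv, Fin.prod_univ_succ, Fin.sum_univ_succ, mul_assoc, add_assoc]
    have e2 : ∑ ω, p ω * ∫ y, h (u + ξ ω + y) ∂gaussianReal (k * a) (k * v) =
        ∫ y, ∑ ω, p ω * h (u + y + ξ ω) ∂gaussianReal (k * a) (k * v) := by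
      rw [integral_finsetSum]
      · refine Finset.sum_congr rfl fun ω _ => ?_
        rw [← integral_const_mul]
        simp only [add_right_comm]
      · intro ω _
        simpa only [add_right_comm] using (hshift _ (u + ξ ω)).const_mul (p ω)
    have e3 : ∫ y, h (u + y) ∂gaussianReal ((k + 1 : ℕ) * a) ((k + 1 : ℕ) * v) =
        ∫ y, ∫ z, h (u + y + z) ∂gaussianReal a v ∂gaussianReal (k * a) (k * v) := by
      have : gaussianReal ((k + 1 : ℕ) * a) ((k + 1 : ℕ) * v) =
          (gaussianReal (k * a) (k * v)).conv (gaussianReal a v) := by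
        rw [gaussianReal_conv_gaussianReal]
        push_cast
        simp only [add_mul, one_mul]
      rw [this, integral_conv (hshift _ u)]
      simp only [add_assoc]
    have i1 : Integrable (fun y => ∑ ω, p ω * h (u + y + ξ ω)) (gaussianReal (k * a) (k * v)) := by
      refine integrable_finsetSum _ fun ω _ => ?_
      simpa only [add_right_comm] using (hshift _ (u + ξ ω)).const_mul (p ω)
    have i2 : Integrable (fun y => ∫ z, h (u + y + z) ∂gaussianReal a v)
        (gaussianReal (k * a) (k * v)) := by
      have := (hshift ((gaussianReal (k * a) (k * v)).conv (gaussianReal a v)) u)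
      rw [Measure.conv, integrable_map_measure (by fun_prop) (by fun_prop)] at this
      simpa only [Function.comp_def, add_assoc] using this.integral_prod_left
    have b1 : |∑ ω, p ω * F (u + ξ ω) -
        ∑ ω, p ω * ∫ y, h (u + ξ ω + y) ∂gaussianReal (k * a) (k * v)| ≤ k * δ := by
      rw [← Finset.sum_sub_distrib]
      refine (Finset.abs_sum_le_sum_abs _ _).trans ?_
      calc _ ≤ ∑ ω, p ω * (k * δ) := by
            refine Finset.sum_le_sum fun ω _ => ?_
            rw [← mul_sub, abs_mul, abs_of_nonneg (hp ω)]
            exact mul_le_mul_of_nonneg_left (ih _) (hp ω)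
        _ = k * δ := by rw [← Finset.sum_mul, hp1, one_mul]
    have b2 : |∫ y, ∑ ω, p ω * h (u + y + ξ ω) ∂gaussianReal (k * a) (k * v) -
        ∫ y, ∫ z, h (u + y + z) ∂gaussianReal a v ∂gaussianReal (k * a) (k * v)| ≤ δ := by
      rw [← integral_sub i1 i2]
      have := norm_integral_le_of_norm_le_const (μ := gaussianReal (k * a) (k * v))
        (f := fun y => ∑ ω, p ω * h (u + y + ξ ω) - ∫ z, h (u + y + z) ∂gaussianReal a v)
        (C := δ) (Eventually.of_forall fun y => hstep (u + y))
      simpa using this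
    rw [e1, e3]
    rw [e2] at b1
    refine (abs_sub_le _ _ _).trans ((add_le_add b1 b2).trans ?_)
    push_cast
    linarith

theorem integral_sq_gaussianReal_standard : ∫ w, w ^ 2 ∂gaussianReal 0 1 = 1 := by
  have := variance_of_integral_eq_zero (X := id) (μ := gaussianReal 0 1) (by fun_prop)
    (by simp)
  rw [variance_id_gaussianReal] at this
  simpa using this.symm

theorem integrable_pow_gaussianReal_standard (n : ℕ) :
    Integrable (fun w : ℝ => w ^ n) (gaussianReal 0 1) := by
  have := (memLp_id_gaussianReal (μ := 0) (v := 1) n).integrable_norm_pow'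
  refine (integrable_norm_iff (by fun_prop)).1 ?_
  simpa using this

theorem integrable_one_add_abs_pow_gaussianReal_standard :
    Integrable (fun w : ℝ => (1 + |w|) ^ 3) (gaussianReal 0 1) := by
  have h := fun n => (integrable_pow_gaussianReal_standard n).norm
  have := (((h 0).add ((h 1).const_mul 3)).add ((h 2).const_mul 3)).add (h 3)
  refine this.congr (Eventually.of_forall fun w => ?_)
  simp
  ring_nf
  simp
  ring

theorem abs_integral_gaussianReal_taylor_le {h : ℝ → ℝ} {u a b p q B τ : ℝ}
    (hc : Continuous h) (hb : ∀ y, |h y| ≤ 1) (hq : |q| ≤ 1)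
    (ht : ∀ y, |h (u + y) - h u - p * y - q * y ^ 2| ≤ |y| ^ 3)
    (hτ : 0 ≤ τ) (hτ1 : τ ≤ 1) (hB : 0 ≤ B) (ha : |a| ≤ B * τ ^ 2) (hbB : |b| ≤ B * τ) :
    |∫ w, h (u + (a + b * w)) ∂gaussianReal 0 1 - h u - p * a - q * b ^ 2| ≤
      (B ^ 3 * ∫ w, (1 + |w|) ^ 3 ∂gaussianReal 0 1 + B ^ 2) * τ ^ 3 := by
  have i0 : Integrable (fun w => h (u + (a + b * w))) (gaussianReal 0 1) :=
    integrable_of_continuous_of_abs_le_one (by fun_prop) fun y => hb _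
  have i1 : Integrable (fun w : ℝ => w) (gaussianReal 0 1) := by
    simpa using integrable_pow_gaussianReal_standard 1
  have i2 := integrable_pow_gaussianReal_standard 2
  have i3 := integrable_one_add_abs_pow_gaussianReal_standard
  have il : Integrable (fun w => (h u + p * a + q * a ^ 2) + (p * b + 2 * q * a * b) * w)
      (gaussianReal 0 1) := (integrable_const _).add (i1.const_mul _)
  have ip : Integrable (fun w => (h u + p * a + q * a ^ 2) + (p * b + 2 * q * a * b) * w +
      q * b ^ 2 * w ^ 2) (gaussianReal 0 1) :=
    il.add (i2.const_mul _)
  have ep : ∫ w, ((h u + p * a + q * a ^ 2) + (p * b + 2 * q * a * b) * w +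
      q * b ^ 2 * w ^ 2) ∂gaussianReal 0 1 = h u + p * a + q * a ^ 2 + q * b ^ 2 := by
    rw [integral_add il (i2.const_mul _),
      integral_add (integrable_const _) (i1.const_mul _), integral_const_mul,
      integral_const_mul, integral_sq_gaussianReal_standard, integral_id_gaussianReal]
    simp
  have bd : |∫ w, (h (u + (a + b * w)) - ((h u + p * a + q * a ^ 2) +
      (p * b + 2 * q * a * b) * w + q * b ^ 2 * w ^ 2)) ∂gaussianReal 0 1| ≤
      ∫ w, (B * τ) ^ 3 * (1 + |w|) ^ 3 ∂gaussianReal 0 1 := by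
    rw [← Real.norm_eq_abs]
    refine norm_integral_le_of_norm_le (i3.const_mul _) (Eventually.of_forall fun w => ?_)
    have hab : |a + b * w| ≤ B * τ * (1 + |w|) := by
      refine (abs_add_le _ _).trans ?_
      rw [abs_mul, mul_add, mul_one]
      gcongr
      refine ha.trans ?_
      have : 0 ≤ B * τ := by positivity
      nlinarith
    rw [Real.norm_eq_abs, ← mul_pow]
    refine le_trans (le_of_eq ?_) ((ht (a + b * w)).trans (pow_le_pow_left₀ (abs_nonneg _) hab 3))
    congr 1
    ring
  rw [integral_sub i0 ip, ep, integral_const_mul] at bd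
  have hqa : |q * a ^ 2| ≤ B ^ 2 * τ ^ 3 := by
    rw [abs_mul, abs_pow]
    calc |q| * |a| ^ 2 ≤ 1 * (B * τ ^ 2) ^ 2 := by gcongr
      _ = B ^ 2 * τ ^ 3 * τ := by ring
      _ ≤ B ^ 2 * τ ^ 3 * 1 := by gcongr
      _ = _ := mul_one _
  have e : ∫ w, h (u + (a + b * w)) ∂gaussianReal 0 1 - h u - p * a - q * b ^ 2 =
      (∫ w, h (u + (a + b * w)) ∂gaussianReal 0 1 - (h u + p * a + q * a ^ 2 + q * b ^ 2)) +
        q * a ^ 2 := by ring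
  rw [e]
  refine (abs_add_le _ _).trans ((add_le_add bd hqa).trans (le_of_eq ?_))
  ring

end Gaussian

section OneStep

open MeasureTheory ProbabilityTheory
open scoped NNReal

variable {π1 π2 : ℝ}

theorem abs_taylor_comp_le {g α β t τ p q A B K : ℝ} {h : ℝ → ℝ} {u : ℝ}
    (hp : |p| ≤ 1) (hq : |q| ≤ 1)
    (ht : ∀ y, |h (u + y) - h u - p * y - q * y ^ 2| ≤ |y| ^ 3)
    (hg : |g - α * t - β * t ^ 2| ≤ K * |t| ^ 3) (htτ : |t| ≤ τ) (hτ1 : τ ≤ 1)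
    (hα : |α| ≤ A) (hβ : |β| ≤ B) (hK : 0 ≤ K) :
    |h (u + g) - (h u + (p * α) * t + (p * β + q * α ^ 2) * t ^ 2)| ≤
      ((A + B + K) ^ 3 + K + 2 * (A + B + K) ^ 2) * τ ^ 3 := by
  have hτ : 0 ≤ τ := (abs_nonneg t).trans htτ
  have hA : 0 ≤ A := (abs_nonneg α).trans hα
  have hB : 0 ≤ B := (abs_nonneg β).trans hβ
  have ht2 : |t| ^ 2 ≤ τ ^ 2 := by gcongr
  have ht3 : |t| ^ 3 ≤ τ ^ 3 := by gcongr
  have hτ32 : τ ^ 3 ≤ τ ^ 2 := pow_le_pow_of_le_one hτ hτ1 (by norm_num)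
  have hτ21 : τ ^ 2 ≤ τ := by nlinarith
  have e1 : |α * t| ≤ A * τ := by rw [abs_mul]; gcongr
  have e2 : |β * t ^ 2| ≤ B * τ ^ 2 := by rw [abs_mul, abs_pow]; gcongr
  have e3 : |g - α * t - β * t ^ 2| ≤ K * τ ^ 3 := hg.trans (by gcongr)
  have e4 : |g - α * t| ≤ (A + B + K) * τ ^ 2 := by
    have : g - α * t = (g - α * t - β * t ^ 2) + β * t ^ 2 := by ring
    rw [this]
    refine (abs_add_le _ _).trans ?_
    have : K * τ ^ 3 ≤ K * τ ^ 2 := by gcongr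
    have : 0 ≤ A * τ ^ 2 := by positivity
    linarith
  have e4' : |g - α * t| ≤ (B + K) * τ := by
    have : g - α * t = (g - α * t - β * t ^ 2) + β * t ^ 2 := by ring
    rw [this]
    refine (abs_add_le _ _).trans ?_
    have : K * τ ^ 3 ≤ K * τ := by gcongr; exact hτ32.trans hτ21
    have : B * τ ^ 2 ≤ B * τ := by gcongr
    linarith
  have e5 : |g| ≤ (A + B + K) * τ := by
    have : g = (g - α * t) + α * t := by ring
    rw [this]
    refine (abs_add_le _ _).trans ?_
    linarith
  have e6 : |g + α * t| ≤ 2 * (A + B + K) * τ := by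
    refine (abs_add_le _ _).trans ?_
    have : 0 ≤ (B + K) * τ := by positivity
    linarith
  have e7 : |q * ((g - α * t) * (g + α * t))| ≤ 2 * (A + B + K) ^ 2 * τ ^ 3 := by
    rw [abs_mul, abs_mul]
    calc _ ≤ 1 * (((A + B + K) * τ ^ 2) * (2 * (A + B + K) * τ)) := by gcongr
      _ = _ := by ring
  have e8 : |p * (g - α * t - β * t ^ 2)| ≤ K * τ ^ 3 := by
    rw [abs_mul]
    calc _ ≤ 1 * (K * τ ^ 3) := by gcongr
      _ = _ := one_mul _
  have e9 : |g| ^ 3 ≤ (A + B + K) ^ 3 * τ ^ 3 := by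
    rw [← mul_pow]
    gcongr
  have e : h (u + g) - (h u + (p * α) * t + (p * β + q * α ^ 2) * t ^ 2) =
      (h (u + g) - h u - p * g - q * g ^ 2) + p * (g - α * t - β * t ^ 2) +
        q * ((g - α * t) * (g + α * t)) := by ring
  rw [e]
  refine (abs_add_le _ _).trans ((add_le_add (abs_add_le _ _) le_rfl).trans ?_)
  linarith [ht g]

/-- One summand of the log-likelihood ratio agrees with a matching Gaussian up to a cubic error,
when tested against the logistic function. -/
theorem exists_one_step_bound (h2 : 0 < π2) (h21 : π2 ≤ π1) (hsum : π1 + π2 = 1) :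
    ∃ C : ℝ, 0 ≤ C ∧ ∀ {Ω : Type} [Fintype Ω] (p t : Ω → ℝ) (τ x a b : ℝ) (v : ℝ≥0),
      (∀ ω, 0 ≤ p ω) → ∑ ω, p ω = 1 → (∀ ω, |t ω| ≤ τ) → 0 ≤ τ → τ ≤ π2 / 2 → 0 ≤ x → x ≤ 1 →
      ∑ ω, p ω * t ω = τ ^ 2 * x →
      |∑ ω, p ω * t ω ^ 2 - τ ^ 2 * (π1 * x)| ≤ τ ^ 3 →
      a = ((1 / π1 + 1 / π2) + (1 / π2 ^ 2 - 1 / π1 ^ 2) / 2 * π1) * (τ ^ 2 * x) →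
      b ^ 2 = (1 / π1 + 1 / π2) ^ 2 * (τ ^ 2 * (π1 * x)) → (v : ℝ) = b ^ 2 →
      ∀ u, |∑ ω, p ω * logitPost π1 π2 (u + llr π1 π2 (t ω)) -
        ∫ y, logitPost π1 π2 (u + y) ∂gaussianReal a v| ≤ C * τ ^ 3 := by
  have h1 : 0 < π1 := h2.trans_le h21
  set α := 1 / π1 + 1 / π2 with hα
  set β := (1 / π2 ^ 2 - 1 / π1 ^ 2) / 2 with hβ
  set K := 4 / π2 ^ 3 with hK
  have hK0 : 0 ≤ K := by positivity
  have hα0 : 0 ≤ α := by positivity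
  set B := α + |β| + K with hB
  have hB0 : 0 ≤ B := by positivity
  set C1 := B ^ 3 + K + 2 * B ^ 2 with hC1
  set G := ∫ w, (1 + |w|) ^ 3 ∂gaussianReal 0 1 with hG
  have hG0 : 0 ≤ G := integral_nonneg fun w => by positivity
  refine ⟨C1 + (|β| + α ^ 2) + (B ^ 3 * G + B ^ 2), by positivity, ?_⟩
  intro Ω _ p t τ x a b v hp hp1 htτ hτ hτ2 hx hx1 hS1 hS2 ha hb hv u
  have hτ1 : τ ≤ 1 := by linarith
  obtain ⟨c, q, hc, hq, ht⟩ := exists_taylor_logitPost h1 h2 u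
  have hbd : ∀ y, |logitPost π1 π2 y| ≤ 1 := fun y => by
    rw [abs_of_nonneg (logitPost_mem h1 h2 y).1]
    exact (logitPost_mem h1 h2 y).2
  set ψ := logitPost π1 π2 with hψ
  have hcont : Continuous ψ := continuous_logitPost h1 h2
  have haB : |a| ≤ B * τ ^ 2 := by
    rw [ha, abs_mul, abs_of_nonneg (show 0 ≤ τ ^ 2 * x by positivity)]
    have : |α + β * π1| ≤ B := by
      refine (abs_add_le _ _).trans ?_
      rw [abs_mul, abs_of_nonneg hα0, abs_of_pos h1]
      have : |β| * π1 ≤ |β| * 1 := by gcongr; linarith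
      linarith
    have : τ ^ 2 * x ≤ τ ^ 2 * 1 := by gcongr
    rw [mul_one] at this
    gcongr
  have hbB : |b| ≤ B * τ := by
    refine abs_le_of_sq_le_sq ?_ (by positivity)
    rw [hb, mul_pow]
    have hαB : α ≤ B := by linarith [abs_nonneg β]
    have : π1 * x ≤ 1 := mul_le_one₀ (by linarith) hx hx1
    calc α ^ 2 * (τ ^ 2 * (π1 * x)) ≤ B ^ 2 * (τ ^ 2 * 1) := by gcongr
      _ = _ := by ring
  have bG := abs_integral_gaussianReal_taylor_le hcont hbd hq ht hτ hτ1 hB0 haB hbB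
  rw [integral_gaussianReal_eq_standard (h := fun y => ψ (u + y)) (by fun_prop) a b hv]
  have bP : |∑ ω, p ω * ψ (u + llr π1 π2 (t ω)) -
      (ψ u + c * α * ∑ ω, p ω * t ω + (c * β + q * α ^ 2) * ∑ ω, p ω * t ω ^ 2)| ≤
      C1 * τ ^ 3 := by
    have e : ∑ ω, p ω * ψ (u + llr π1 π2 (t ω)) -
      (ψ u + c * α * ∑ ω, p ω * t ω + (c * β + q * α ^ 2) * ∑ ω, p ω * t ω ^ 2) =
      ∑ ω, p ω * (ψ (u + llr π1 π2 (t ω)) -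
        (ψ u + (c * α) * t ω + (c * β + q * α ^ 2) * t ω ^ 2)) := by
      have e0 : ψ u = ∑ ω, p ω * ψ u := by rw [← Finset.sum_mul, hp1, one_mul]
      conv_lhs => rw [e0]
      rw [Finset.mul_sum, Finset.mul_sum, ← Finset.sum_add_distrib, ← Finset.sum_add_distrib,
        ← Finset.sum_sub_distrib]
      refine Finset.sum_congr rfl fun ω _ => ?_
      ring
    rw [e]
    refine (Finset.abs_sum_le_sum_abs _ _).trans ?_
    calc _ ≤ ∑ ω, p ω * (C1 * τ ^ 3) := by
          refine Finset.sum_le_sum fun ω _ => ?_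
          rw [abs_mul, abs_of_nonneg (hp ω)]
          exact mul_le_mul_of_nonneg_left (abs_taylor_comp_le hc hq ht
            (abs_llr_sub_le h2 h21 ((htτ ω).trans hτ2)) (htτ ω) hτ1 (abs_of_nonneg hα0).le le_rfl
            hK0) (hp ω)
      _ = _ := by rw [← Finset.sum_mul, hp1, one_mul]
  have bM : |(c * β + q * α ^ 2) * (∑ ω, p ω * t ω ^ 2 - τ ^ 2 * (π1 * x))| ≤
      (|β| + α ^ 2) * τ ^ 3 := by
    rw [abs_mul]
    gcongr
    refine (abs_add_le _ _).trans ?_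
    rw [abs_mul, abs_mul, abs_pow, sq_abs]
    have e1 : |c| * |β| ≤ 1 * |β| := by gcongr
    have e2 : |q| * α ^ 2 ≤ 1 * α ^ 2 := by gcongr
    linarith
  have e : ∑ ω, p ω * ψ (u + llr π1 π2 (t ω)) - ∫ w, ψ (u + (a + b * w)) ∂gaussianReal 0 1 =
      (∑ ω, p ω * ψ (u + llr π1 π2 (t ω)) -
        (ψ u + c * α * ∑ ω, p ω * t ω + (c * β + q * α ^ 2) * ∑ ω, p ω * t ω ^ 2)) +
      (c * β + q * α ^ 2) * (∑ ω, p ω * t ω ^ 2 - τ ^ 2 * (π1 * x)) -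
      (∫ w, ψ (u + (a + b * w)) ∂gaussianReal 0 1 - ψ u - c * a - q * b ^ 2) := by
    rw [hS1, ha, hb]
    ring
  rw [e]
  refine (abs_sub _ _).trans ((add_le_add (abs_add_le _ _) le_rfl).trans ?_)
  linarith

end OneStep

/-! ### Moments of the posterior -/

theorem pst_Dlt_zero {θ π1 π2 : ℝ} (hθ : θ ≠ 1) (hsum : π1 + π2 = 1) :
    pst θ (Dlt θ π1 π2) 0 = π1 := by
  have : 1 - θ ≠ 0 := sub_ne_zero.2 hθ.symm
  simp only [pst, Dlt, if_true]
  field_simp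
  linarith

theorem pst_Dlt_one {θ π1 π2 : ℝ} (hθ : θ ≠ 1) (hsum : π1 + π2 = 1) :
    pst θ (Dlt θ π1 π2) 1 = π2 := by
  have : 1 - θ ≠ 0 := sub_ne_zero.2 hθ.symm
  simp only [pst, Dlt, one_ne_zero, if_false]
  field_simp
  linarith

theorem Mmat_Dlt {θ π1 π2 : ℝ} (hsum : π1 + π2 = 1) :
    Mmat θ (Dlt θ π1 π2) 0 0 = π1 + θ * π2 ∧ Mmat θ (Dlt θ π1 π2) 0 1 = (1 - θ) * π2 ∧
      Mmat θ (Dlt θ π1 π2) 1 0 = (1 - θ) * π1 ∧ Mmat θ (Dlt θ π1 π2) 1 1 = π2 + θ * π1 := by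
  obtain rfl : π2 = 1 - π1 := by linarith
  refine ⟨?_, ?_, ?_, ?_⟩ <;> simp [Mmat, Dlt] <;> ring

theorem prod_posterior_eq_logitPost {ι : Type*} [Fintype ι] {π1 π2 : ℝ} {a b : ι → ℝ}
    (ha : ∀ j, 0 < a j) (hb : ∀ j, 0 < b j) :
    (π1 * ∏ j, a j) / (π1 * (∏ j, a j) + π2 * ∏ j, b j) =
      logitPost π1 π2 (∑ j, (Real.log (a j) - Real.log (b j))) := by
  have hA : 0 < ∏ j, a j := Finset.prod_pos fun j _ => ha j
  have e : Real.exp (-∑ j, (Real.log (a j) - Real.log (b j))) = (∏ j, b j) / ∏ j, a j := by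
    rw [Finset.sum_sub_distrib, neg_sub, Real.exp_sub, Real.exp_sum, Real.exp_sum]
    simp only [Real.exp_log (ha _), Real.exp_log (hb _)]
  rw [logitPost, e, ← mul_div_mul_right π1 (π1 + π2 * ((∏ j, b j) / ∏ j, a j)) hA.ne']
  congr 1
  field_simp

section Posterior

variable {d : ℕ} {θ π1 π2 : ℝ}

theorem levelProb_pos (hM : ∀ i j, 0 < Mmat θ (Dlt θ π1 π2) i j) (hsum : π1 + π2 = 1)
    (h1 : 0 < π1) (h2 : 0 < π2) (hθ : θ ≠ 1) (n : ℕ) (A : LConf d n) :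
    0 < levelProb d θ (Dlt θ π1 π2) n A := by
  rw [levelProb_eq, pst_Dlt_zero hθ hsum, pst_Dlt_one hθ hsum]
  have l0 := lik_nonneg hM n 0 A
  have l1 := lik_nonneg hM n 1 A
  rcases lik_pos_or hM n A with h | h <;> positivity

theorem mul_lik_zero_eq (hM : ∀ i j, 0 < Mmat θ (Dlt θ π1 π2) i j) (hsum : π1 + π2 = 1)
    (h1 : 0 < π1) (h2 : 0 < π2) (hθ : θ ≠ 1) (n : ℕ) (A : LConf d n) :
    π1 * lik d θ (Dlt θ π1 π2) n 0 A =
      levelProb d θ (Dlt θ π1 π2) n A * post d θ (Dlt θ π1 π2) n 0 A := by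
  rw [post, mul_div_cancel₀ _ (levelProb_pos hM hsum h1 h2 hθ n A).ne', jointProb_eq,
    pst_Dlt_zero hθ hsum]

theorem mul_lik_one_eq (hM : ∀ i j, 0 < Mmat θ (Dlt θ π1 π2) i j) (hsum : π1 + π2 = 1)
    (h1 : 0 < π1) (h2 : 0 < π2) (hθ : θ ≠ 1) (n : ℕ) (A : LConf d n) :
    π2 * lik d θ (Dlt θ π1 π2) n 1 A =
      levelProb d θ (Dlt θ π1 π2) n A * (1 - post d θ (Dlt θ π1 π2) n 0 A) := by
  rw [mul_sub, mul_one, ← mul_lik_zero_eq hM hsum h1 h2 hθ, levelProb_eq, pst_Dlt_zero hθ hsum,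
    pst_Dlt_one hθ hsum]
  ring

theorem post_mem (hM : ∀ i j, 0 < Mmat θ (Dlt θ π1 π2) i j) (hsum : π1 + π2 = 1)
    (h1 : 0 < π1) (h2 : 0 < π2) (hθ : θ ≠ 1) (n : ℕ) (A : LConf d n) :
    0 ≤ post d θ (Dlt θ π1 π2) n 0 A ∧ post d θ (Dlt θ π1 π2) n 0 A ≤ 1 := by
  have hq := levelProb_pos hM hsum h1 h2 hθ n A
  have e0 := mul_lik_zero_eq hM hsum h1 h2 hθ n A
  have e1 := mul_lik_one_eq hM hsum h1 h2 hθ n A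
  have l0 := mul_nonneg h1.le (lik_nonneg hM n 0 A)
  have l1 := mul_nonneg h2.le (lik_nonneg hM n 1 A)
  rw [e0] at l0
  rw [e1] at l1
  exact ⟨nonneg_of_mul_nonneg_right l0 hq, by linarith [nonneg_of_mul_nonneg_right l1 hq]⟩

/-- The law of the level-`n` spins below a child of the root, given that the root spin is `0`. -/
noncomputable def childLaw (d : ℕ) (θ π1 π2 : ℝ) (n : ℕ) (A : LConf d n) : ℝ :=
  Mmat θ (Dlt θ π1 π2) 0 0 * lik d θ (Dlt θ π1 π2) n 0 A +
    Mmat θ (Dlt θ π1 π2) 0 1 * lik d θ (Dlt θ π1 π2) n 1 A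

/-- The weighted posterior deviation of a child. -/
noncomputable def childDev (d : ℕ) (θ π1 π2 : ℝ) (n : ℕ) (A : LConf d n) : ℝ :=
  θ * (post d θ (Dlt θ π1 π2) n 0 A - π1)

theorem childLaw_nonneg (hM : ∀ i j, 0 < Mmat θ (Dlt θ π1 π2) i j) (n : ℕ) (A : LConf d n) :
    0 ≤ childLaw d θ π1 π2 n A :=
  add_nonneg (mul_nonneg (hM _ _).le (lik_nonneg hM _ _ _))
    (mul_nonneg (hM _ _).le (lik_nonneg hM _ _ _))

theorem sum_childLaw (n : ℕ) : ∑ A, childLaw d θ π1 π2 n A = 1 := by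
  simp [childLaw, Finset.sum_add_distrib, ← Finset.mul_sum, sum_lik, Mmat_row_sum]

theorem childLaw_eq (hsum : π1 + π2 = 1) (hθ : θ ≠ 1) (n : ℕ) (A : LConf d n) :
    childLaw d θ π1 π2 n A =
      (1 - θ) * levelProb d θ (Dlt θ π1 π2) n A + θ * lik d θ (Dlt θ π1 π2) n 0 A := by
  obtain ⟨m0, m1, -, -⟩ := Mmat_Dlt (θ := θ) hsum
  rw [childLaw, m0, m1, levelProb_eq, pst_Dlt_zero hθ hsum, pst_Dlt_one hθ hsum]
  linear_combination (θ * lik d θ (Dlt θ π1 π2) n 0 A) * hsum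

theorem xseq_eq (hsum : π1 + π2 = 1) (h1 : 0 < π1) (hθ : θ ≠ 1) (n : ℕ) :
    xseq d θ (Dlt θ π1 π2) n =
      ∑ A, lik d θ (Dlt θ π1 π2) n 0 A * (post d θ (Dlt θ π1 π2) n 0 A - π1) := by
  simp only [mul_sub, Finset.sum_sub_distrib, ← Finset.sum_mul, sum_lik, one_mul]
  simp only [xseq, expect1, condLevel, jointProb_eq, pst_Dlt_zero hθ hsum,
    mul_div_cancel_left₀ _ h1.ne']

theorem sum_levelProb_mul_dev (hM : ∀ i j, 0 < Mmat θ (Dlt θ π1 π2) i j) (hsum : π1 + π2 = 1)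
    (h1 : 0 < π1) (h2 : 0 < π2) (hθ : θ ≠ 1) (n : ℕ) :
    ∑ A, levelProb d θ (Dlt θ π1 π2) n A * (post d θ (Dlt θ π1 π2) n 0 A - π1) = 0 := by
  have e : ∀ A : LConf d n,
      levelProb d θ (Dlt θ π1 π2) n A * (post d θ (Dlt θ π1 π2) n 0 A - π1) =
        π1 * lik d θ (Dlt θ π1 π2) n 0 A - π1 *
          (π1 * lik d θ (Dlt θ π1 π2) n 0 A + π2 * lik d θ (Dlt θ π1 π2) n 1 A) := by
    intro A
    rw [mul_sub, ← mul_lik_zero_eq hM hsum h1 h2 hθ, levelProb_eq, pst_Dlt_zero hθ hsum,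
      pst_Dlt_one hθ hsum]
    ring
  simp only [e, Finset.sum_sub_distrib, Finset.sum_add_distrib, ← Finset.mul_sum, sum_lik]
  linear_combination -π1 * hsum

theorem sum_levelProb_mul_dev_sq (hM : ∀ i j, 0 < Mmat θ (Dlt θ π1 π2) i j)
    (hsum : π1 + π2 = 1) (h1 : 0 < π1) (h2 : 0 < π2) (hθ : θ ≠ 1) (n : ℕ) :
    ∑ A, levelProb d θ (Dlt θ π1 π2) n A * (post d θ (Dlt θ π1 π2) n 0 A - π1) ^ 2 =
      π1 * xseq d θ (Dlt θ π1 π2) n := by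
  have h0 := sum_levelProb_mul_dev (d := d) hM hsum h1 h2 hθ n
  rw [xseq_eq hsum h1 hθ, Finset.mul_sum, ← sub_eq_zero, ← Finset.sum_sub_distrib]
  rw [← mul_zero (-π1), ← h0, Finset.mul_sum]
  refine Finset.sum_congr rfl fun A _ => ?_
  linear_combination
    (-(post d θ (Dlt θ π1 π2) n 0 A - π1)) * mul_lik_zero_eq hM hsum h1 h2 hθ n A

theorem xseq_mem (hM : ∀ i j, 0 < Mmat θ (Dlt θ π1 π2) i j) (hsum : π1 + π2 = 1)
    (h1 : 0 < π1) (h2 : 0 < π2) (hθ : θ ≠ 1) (n : ℕ) :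
    0 ≤ xseq d θ (Dlt θ π1 π2) n ∧ xseq d θ (Dlt θ π1 π2) n ≤ 1 := by
  constructor
  · have h := sum_levelProb_mul_dev_sq (d := d) hM hsum h1 h2 hθ n
    have : 0 ≤ π1 * xseq d θ (Dlt θ π1 π2) n := by
      rw [← h]
      exact Finset.sum_nonneg fun A _ =>
        mul_nonneg (levelProb_pos hM hsum h1 h2 hθ n A).le (sq_nonneg _)
    exact nonneg_of_mul_nonneg_right this h1
  · rw [xseq_eq hsum h1 hθ, ← sum_lik d θ (Dlt θ π1 π2) n 0]
    refine Finset.sum_le_sum fun A _ => mul_le_of_le_one_right (lik_nonneg hM n 0 A) ?_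
    linarith [(post_mem hM hsum h1 h2 hθ n A).2]

theorem sum_childLaw_mul_childDev (hM : ∀ i j, 0 < Mmat θ (Dlt θ π1 π2) i j)
    (hsum : π1 + π2 = 1) (h1 : 0 < π1) (h2 : 0 < π2) (hθ : θ ≠ 1) (n : ℕ) :
    ∑ A, childLaw d θ π1 π2 n A * childDev d θ π1 π2 n A =
      θ ^ 2 * xseq d θ (Dlt θ π1 π2) n := by
  have e : ∀ A : LConf d n, childLaw d θ π1 π2 n A * childDev d θ π1 π2 n A =
      (1 - θ) * θ *
        (levelProb d θ (Dlt θ π1 π2) n A * (post d θ (Dlt θ π1 π2) n 0 A - π1)) +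
      θ ^ 2 * (lik d θ (Dlt θ π1 π2) n 0 A * (post d θ (Dlt θ π1 π2) n 0 A - π1)) := by
    intro A
    rw [childLaw_eq hsum hθ, childDev]
    ring
  simp only [e, Finset.sum_add_distrib, ← Finset.mul_sum,
    sum_levelProb_mul_dev hM hsum h1 h2 hθ, ← xseq_eq hsum h1 hθ]
  ring

theorem abs_sum_childLaw_mul_childDev_sq_sub_le (hM : ∀ i j, 0 < Mmat θ (Dlt θ π1 π2) i j)
    (hsum : π1 + π2 = 1) (h1 : 0 < π1) (h2 : 0 < π2) (hθ : θ ≠ 1) (n : ℕ) :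
    |∑ A, childLaw d θ π1 π2 n A * childDev d θ π1 π2 n A ^ 2 -
      θ ^ 2 * (π1 * xseq d θ (Dlt θ π1 π2) n)| ≤ |θ| ^ 3 := by
  set z := ∑ A, lik d θ (Dlt θ π1 π2) n 0 A * (post d θ (Dlt θ π1 π2) n 0 A - π1) ^ 2 with hz
  have e : ∀ A : LConf d n, childLaw d θ π1 π2 n A * childDev d θ π1 π2 n A ^ 2 =
      (1 - θ) * θ ^ 2 *
        (levelProb d θ (Dlt θ π1 π2) n A * (post d θ (Dlt θ π1 π2) n 0 A - π1) ^ 2) +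
      θ ^ 3 * (lik d θ (Dlt θ π1 π2) n 0 A * (post d θ (Dlt θ π1 π2) n 0 A - π1) ^ 2) := by
    intro A
    rw [childLaw_eq hsum hθ, childDev]
    ring
  simp only [e, Finset.sum_add_distrib, ← Finset.mul_sum,
    sum_levelProb_mul_dev_sq hM hsum h1 h2 hθ, ← hz]
  obtain ⟨x0, x1⟩ := xseq_mem (d := d) hM hsum h1 h2 hθ n
  have z0 : 0 ≤ z := Finset.sum_nonneg fun A _ => mul_nonneg (lik_nonneg hM n 0 A) (sq_nonneg _)
  have z1 : z ≤ 1 := by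
    rw [hz, ← sum_lik d θ (Dlt θ π1 π2) n 0]
    refine Finset.sum_le_sum fun A _ => mul_le_of_le_one_right (lik_nonneg hM n 0 A) ?_
    obtain ⟨p0, p1⟩ := post_mem hM hsum h1 h2 hθ n A
    exact (sq_le_one_iff_abs_le_one _).2 (abs_le.2 ⟨by linarith, by linarith⟩)
  have y0 : 0 ≤ π1 * xseq d θ (Dlt θ π1 π2) n := mul_nonneg h1.le x0
  have y1 : π1 * xseq d θ (Dlt θ π1 π2) n ≤ 1 := mul_le_one₀ (by linarith) x0 x1
  generalize π1 * xseq d θ (Dlt θ π1 π2) n = y at *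
  have : (1 - θ) * θ ^ 2 * y + θ ^ 3 * z - θ ^ 2 * y = θ ^ 3 * (z - y) := by ring
  rw [this, abs_mul, abs_pow]
  exact mul_le_of_le_one_right (by positivity) (abs_le.2 ⟨by linarith, by linarith⟩)

/-- The recursion: one level up, the posterior is the logistic function of a sum of independent
log-likelihood ratios. -/
theorem xseq_succ_eq (hM : ∀ i j, 0 < Mmat θ (Dlt θ π1 π2) i j) (hsum : π1 + π2 = 1)
    (h1 : 0 < π1) (h2 : 0 < π2) (hθ : θ ≠ 1) (n : ℕ) :
    xseq d θ (Dlt θ π1 π2) (n + 1) =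
      ∑ B : Fin d → LConf d n, (∏ j, childLaw d θ π1 π2 n (B j)) *
        logitPost π1 π2 (∑ j, llr π1 π2 (childDev d θ π1 π2 n (B j))) - π1 := by
  set Δ := Dlt θ π1 π2 with hΔ
  obtain ⟨m00, m01, m10, m11⟩ := Mmat_Dlt (θ := θ) hsum
  have f0 : ∀ A : LConf d n, Mmat θ Δ 0 0 * lik d θ Δ n 0 A + Mmat θ Δ 0 1 * lik d θ Δ n 1 A =
      levelProb d θ Δ n A * (1 + childDev d θ π1 π2 n A / π1) := by
    intro A
    have e0 := mul_lik_zero_eq hM hsum h1 h2 hθ n A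
    have e1 := mul_lik_one_eq hM hsum h1 h2 hθ n A
    rw [m00, m01, childDev, ← hΔ]
    field_simp
    linear_combination (π1 + θ * π2) * e0 + (1 - θ) * π1 * e1 +
      levelProb d θ Δ n A * θ * post d θ Δ n 0 A * hsum
  have f1 : ∀ A : LConf d n, Mmat θ Δ 1 0 * lik d θ Δ n 0 A + Mmat θ Δ 1 1 * lik d θ Δ n 1 A =
      levelProb d θ Δ n A * (1 - childDev d θ π1 π2 n A / π2) := by
    intro A
    have e0 := mul_lik_zero_eq hM hsum h1 h2 hθ n A
    have e1 := mul_lik_one_eq hM hsum h1 h2 hθ n A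
    rw [m10, m11, childDev, ← hΔ]
    field_simp
    linear_combination (1 - θ) * π2 * e0 + (π2 + θ * π1) * e1 -
      levelProb d θ Δ n A * θ * post d θ Δ n 0 A * hsum
  have hq : ∀ A : LConf d n, 0 < levelProb d θ Δ n A := levelProb_pos hM hsum h1 h2 hθ n
  have hpos : ∀ (i : Fin 2) (A : LConf d n),
      0 < Mmat θ Δ i 0 * lik d θ Δ n 0 A + Mmat θ Δ i 1 * lik d θ Δ n 1 A := by
    intro i A
    have l0 := lik_nonneg hM n 0 A
    have l1 := lik_nonneg hM n 1 A
    have := hM i 0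
    have := hM i 1
    rcases lik_pos_or hM n A with h | h <;> positivity
  have hpost : ∀ B : Fin d → LConf d n, post d θ Δ (n + 1) 0 ((lconfEquiv d n).symm B) =
      logitPost π1 π2 (∑ j, llr π1 π2 (childDev d θ π1 π2 n (B j))) := by
    intro B
    rw [post, jointProb_eq, levelProb_eq, pst_Dlt_zero hθ hsum, pst_Dlt_one hθ hsum, lik_succ,
      lik_succ, prod_posterior_eq_logitPost (fun j => hpos 0 (B j)) (fun j => hpos 1 (B j))]
    congr 1
    refine Finset.sum_congr rfl fun j _ => ?_
    have p0 := hpos 0 (B j)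
    have p1 := hpos 1 (B j)
    rw [f0] at p0 ⊢
    rw [f1] at p1 ⊢
    rw [Real.log_mul (hq _).ne' (pos_of_mul_pos_right p0 (hq _).le).ne',
      Real.log_mul (hq _).ne' (pos_of_mul_pos_right p1 (hq _).le).ne', llr]
    ring
  rw [xseq_eq hsum h1 hθ]
  simp only [mul_sub, Finset.sum_sub_distrib, ← Finset.sum_mul, sum_lik, one_mul]
  congr 1
  rw [← (lconfEquiv d n).symm.sum_comp]
  refine Finset.sum_congr rfl fun B _ => ?_
  rw [hpost, lik_succ]
  rfl

end Posterior

theorem gfun_eq_integral_logitPost {π1 π2 s : ℝ} (h1 : 0 < π1) (h2 : 0 < π2)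
    (hsum : π1 + π2 = 1) :
    gfun π1 π2 s = (∫ w, logitPost π1 π2
      (s * ((1 / π1 + 1 / π2) + (1 / π2 ^ 2 - 1 / π1 ^ 2) / 2 * π1) +
        √s * ((1 / π1 + 1 / π2) * √π1) * w) ∂ProbabilityTheory.gaussianReal 0 1) - π1 := by
  rw [gfun]
  congr 2
  funext w
  have hs : √π1 ≠ 0 := (Real.sqrt_pos.2 h1).ne'
  have hm : 1 / (2 * π1) - -(1 + π2) / (2 * π2 ^ 2) =
      (1 / π1 + 1 / π2) + (1 / π2 ^ 2 - 1 / π1 ^ 2) / 2 * π1 := by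
    field_simp
    obtain rfl : π2 = 1 - π1 := by linarith
    ring
  have hk : w / √π1 - -(π1 / π2) * (w / √π1) = (1 / π1 + 1 / π2) * √π1 * w := by
    have : √π1 ^ 2 = π1 := Real.sq_sqrt h1.le
    field_simp
    linear_combination (-(w * (π1 + π2))) * this
  set E := Real.exp (s * (1 / (2 * π1)) + √s * (w / √π1)) with hE
  have hE0 : 0 < E := Real.exp_pos _
  have hexp : Real.exp (s * (-(1 + π2) / (2 * π2 ^ 2)) + √s * (-(π1 / π2) * (w / √π1))) =
      E * Real.exp (-(s * ((1 / π1 + 1 / π2) + (1 / π2 ^ 2 - 1 / π1 ^ 2) / 2 * π1) +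
        √s * ((1 / π1 + 1 / π2) * √π1) * w)) := by
    rw [hE, ← Real.exp_add]
    congr 1
    linear_combination (-s) * hm - √s * hk
  rw [hexp, logitPost, ← mul_div_mul_right π1 _ hE0.ne']
  congr 1
  ring

/-- Gaussian approximation of the recursion: for every `ε > 0` there is
a `D = D(π, ε) > 0` such that whenever `d > D` and `1/2 ≤ dθ² ≤ 1`, for all `n`,
`|x_{n+1} − f(dθ²x_n)| ≤ ε`. -/
theorem gaussian_approximation (π1 π2 : ℝ) (hsum : π1 + π2 = 1) (hord : π2 ≤ π1)
    (hpi2 : 0 < π2) :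
    ∀ ε : ℝ, 0 < ε → ∃ D : ℝ, 0 < D ∧
      ∀ d : ℕ, D < (d : ℝ) → ∀ θ : ℝ, θ ≠ 0 →
        (∀ i j, 0 < Mmat θ (Dlt θ π1 π2) i j) →
        1 / 2 ≤ (d : ℝ) * θ ^ 2 → (d : ℝ) * θ ^ 2 ≤ 1 →
        ∀ n : ℕ,
          |xseq d θ (Dlt θ π1 π2) (n + 1) -
              gfun π1 π2 ((d : ℝ) * θ ^ 2 * xseq d θ (Dlt θ π1 π2) n)| ≤ ε := by
  intro ε hε
  have h1 : 0 < π1 := hpi2.trans_le hord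
  obtain ⟨C, hC, hstep⟩ := exists_one_step_bound hpi2 hord hsum
  refine ⟨(C / ε) ^ 2 + (2 / π2) ^ 2, by positivity, ?_⟩
  intro d hd θ _ hM _ hdθ n
  have hθ : θ ≠ 1 := by
    rintro rfl
    have := hM 0 1
    rw [(Mmat_Dlt hsum).2.1] at this
    simp at this
  have hd0 : 0 < (d : ℝ) := lt_of_le_of_lt (by positivity) hd
  have hτ : |θ| ≤ π2 / 2 := by
    refine abs_le_of_sq_le_sq ?_ (by positivity)
    have h : (2 / π2) ^ 2 * θ ^ 2 ≤ 1 := by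
      refine le_trans ?_ hdθ
      gcongr
      linarith [sq_nonneg (C / ε)]
    have e : θ ^ 2 = (π2 / 2) ^ 2 * ((2 / π2) ^ 2 * θ ^ 2) := by
      field_simp
    rw [e]
    exact mul_le_of_le_one_right (by positivity) h
  have hCε : C * |θ| ≤ ε := by
    refine le_of_sq_le_sq ?_ hε.le
    have h : (C / ε) ^ 2 * θ ^ 2 ≤ 1 := by
      refine le_trans ?_ hdθ
      gcongr
      linarith [sq_nonneg (2 / π2)]
    have e : (C * |θ|) ^ 2 = ε ^ 2 * ((C / ε) ^ 2 * θ ^ 2) := by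
      rw [mul_pow, sq_abs]
      field_simp
    rw [e]
    exact mul_le_of_le_one_right (by positivity) h
  obtain ⟨x0, x1⟩ := xseq_mem (d := d) hM hsum h1 hpi2 hθ n
  have hS1 := sum_childLaw_mul_childDev (d := d) hM hsum h1 hpi2 hθ n
  have hS2 := abs_sum_childLaw_mul_childDev_sq_sub_le (d := d) hM hsum h1 hpi2 hθ n
  have hmem := post_mem (d := d) hM hsum h1 hpi2 hθ n
  rw [xseq_succ_eq hM hsum h1 hpi2 hθ]
  set x := xseq d θ (Dlt θ π1 π2) n with hx
  set m := (1 / π1 + 1 / π2) + (1 / π2 ^ 2 - 1 / π1 ^ 2) / 2 * π1 with hm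
  set b := (1 / π1 + 1 / π2) * √(θ ^ 2 * (π1 * x)) with hb
  have hb2 : b ^ 2 = (1 / π1 + 1 / π2) ^ 2 * (θ ^ 2 * (π1 * x)) := by
    rw [hb, mul_pow, Real.sq_sqrt (by positivity)]
  have hdev : ∀ A, |childDev d θ π1 π2 n A| ≤ |θ| := by
    intro A
    rw [childDev, abs_mul]
    exact mul_le_of_le_one_right (abs_nonneg _)
      (abs_le.2 ⟨by linarith [(hmem A).1], by linarith [(hmem A).2]⟩)
  have one := hstep (childLaw d θ π1 π2 n) (childDev d θ π1 π2 n) |θ| x (m * (θ ^ 2 * x)) b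
    (b ^ 2).toNNReal (childLaw_nonneg hM n) (sum_childLaw n) hdev (abs_nonneg _) hτ x0 x1
    (by rw [sq_abs, hS1]) (by rw [sq_abs]; exact hS2) (by rw [sq_abs]) (by rw [sq_abs]; exact hb2)
    (Real.coe_toNNReal _ (sq_nonneg b))
  have hcont := continuous_logitPost h1 hpi2
  have hbd : ∀ y, |logitPost π1 π2 y| ≤ 1 := fun y => by
    rw [abs_of_nonneg (logitPost_mem h1 hpi2 y).1]
    exact (logitPost_mem h1 hpi2 y).2
  have main := abs_sum_prod_sub_integral_gaussianReal_le (childLaw_nonneg hM n) (sum_childLaw n)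
    hcont hbd one d 0
  simp only [zero_add] at main
  rw [integral_gaussianReal_eq_standard hcont (d * (m * (θ ^ 2 * x)))
    (√(d * θ ^ 2 * x) * ((1 / π1 + 1 / π2) * √π1)) ?_] at main
  · rw [gfun_eq_integral_logitPost h1 hpi2 hsum, ← hm, sub_sub_sub_cancel_right]
    have e : (d : ℝ) * θ ^ 2 * x * m = d * (m * (θ ^ 2 * x)) := by ring
    rw [e]
    refine main.trans ?_
    calc (d : ℝ) * (C * |θ| ^ 3) = C * |θ| * (d * |θ| ^ 2) := by ring
      _ ≤ C * |θ| * 1 := by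
        rw [sq_abs]
        gcongr
      _ ≤ ε := by rwa [mul_one]
  · push_cast
    rw [Real.coe_toNNReal _ (sq_nonneg b), hb2, mul_pow, mul_pow, Real.sq_sqrt (by positivity),
      Real.sq_sqrt h1.le]
    ring

end AsymIsing
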